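/- arXiv:1204.2871 — 7 statements merged into one kernel-verified Lean document; each statement's English description precedes it below -/
import Mathlib

section
/- Let A be a unital (not necessarily commutative) ring, N ∈ ℕ, C ∈ A, and P : ℕ → A with P(N+1) = 0, satisfying P(n)·C − C·P(n) = −(N−n)·P(n+1) for all 0 ≤ n ≤ N. Then for all h ∈ ℕ and all j with 0 ≤ j ≤ N: P(j)·C^h − C^h·P(j) = Σ_{n=1}^{min(h, N−j)} (−1)^n · n! · C(h,n) · C(N−j,n) · C^{h−n} · P(j+n), where C(a,b) denotes the binomial coefficient. -/
/-- The integer `(-1)^n n! (h choose n) (m choose n)`. -/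
def signedChooseCoeff (h m n : ℕ) : ℤ :=
  (-1) ^ n * n.factorial * h.choose n * m.choose n

lemma signedChooseCoeff_zero (h m : ℕ) : signedChooseCoeff h m 0 = 1 := by
  simp [signedChooseCoeff]

lemma signedChooseCoeff_eq_zero_of_lt {h m n : ℕ} (hn : h < n) : signedChooseCoeff h m n = 0 := by
  simp [signedChooseCoeff, Nat.choose_eq_zero_of_lt hn]

lemma signedChooseCoeff_eq_zero_of_lt' {h m n : ℕ} (hn : m < n) :
    signedChooseCoeff h m n = 0 := by
  simp [signedChooseCoeff, Nat.choose_eq_zero_of_lt hn]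

lemma signedChooseCoeff_succ (h m n : ℕ) :
    signedChooseCoeff (h + 1) (m + 1) (n + 1) =
      signedChooseCoeff h (m + 1) (n + 1) - (m + 1) * signedChooseCoeff h m n := by
  have key : ((m : ℤ) + 1) * m.choose n = (m + 1).choose (n + 1) * (n + 1) :=
    mod_cast Nat.add_one_mul_choose_eq m n
  simp only [signedChooseCoeff, Nat.choose_succ_succ h n, Nat.factorial_succ, pow_succ]
  push_cast
  linear_combination (-1) ^ n * (n.factorial : ℤ) * h.choose n * key

/-- Moving `C ^ h` to the left past `P j` when `[P j, C] = -m P (j + 1)` with `m = N - j`. -/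
lemma mul_pow_eq_sum_signedChooseCoeff {A : Type*} [Ring A] {N : ℕ} {C : A} {P : ℕ → A}
    (hrel : ∀ n : ℕ, n ≤ N → P n * C - C * P n = -(((N - n : ℕ) : A) * P (n + 1)))
    (h m j : ℕ) (hj : j + m = N) :
    P j * C ^ h = ∑ n ∈ Finset.range (h + 1),
      signedChooseCoeff h m n • (C ^ (h - n) * P (j + n)) := by
  induction h generalizing m j with
  | zero => simp [signedChooseCoeff_zero]
  | succ h ih =>
    have hcomm : P j * C = C * P j - (m : ℤ) • P (j + 1) := by
      have := hrel j (by omega)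
      rw [show N - j = m by omega] at this
      rw [zsmul_eq_mul, Int.cast_natCast, sub_eq_add_neg, ← this]
      abel
    rw [pow_succ', ← mul_assoc, hcomm, sub_mul, mul_assoc, ih m j hj]
    have hshift : C * ∑ n ∈ Finset.range (h + 1),
          signedChooseCoeff h m n • (C ^ (h - n) * P (j + n)) =
        ∑ n ∈ Finset.range (h + 1),
          signedChooseCoeff h m (n + 1) • (C ^ (h - n) * P (j + (n + 1))) +
          C ^ (h + 1) * P j := by
      have hmul : C * ∑ n ∈ Finset.range (h + 1),
            signedChooseCoeff h m n • (C ^ (h - n) * P (j + n)) =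
          ∑ n ∈ Finset.range (h + 2),
            signedChooseCoeff h m n • (C ^ (h + 1 - n) * P (j + n)) := by
        rw [Finset.sum_range_succ _ (h + 1), signedChooseCoeff_eq_zero_of_lt (Nat.lt_succ_self h),
          zero_smul, add_zero, Finset.mul_sum]
        refine Finset.sum_congr rfl fun n hn => ?_
        rw [Finset.mem_range] at hn
        rw [mul_smul_comm, ← mul_assoc, ← pow_succ', show h - n + 1 = h + 1 - n by omega]
      rw [hmul, Finset.sum_range_succ' _ (h + 1)]
      simp [signedChooseCoeff_zero]
    rw [hshift, Finset.sum_range_succ' _ (h + 1)]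
    simp only [signedChooseCoeff_zero, one_smul, Nat.add_sub_add_right, Nat.sub_zero, add_zero]
    cases m with
    | zero =>
      simp [signedChooseCoeff_eq_zero_of_lt']
    | succ m =>
      rw [smul_mul_assoc, ih m (j + 1) (by omega), Finset.smul_sum, add_sub_right_comm,
        ← Finset.sum_sub_distrib]
      congr 1
      refine Finset.sum_congr rfl fun n _ => ?_
      rw [signedChooseCoeff_succ, sub_smul, mul_smul, show j + 1 + n = j + (n + 1) by omega,
        Nat.cast_succ]


/-- relation (rel-PC) of Lemma 2. In a unital ring `A`, given
`C : A` and `P : ℕ → A` with `P (N+1) = 0` and `[P n, C] = -(N-n) • P (n+1)`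
for `0 ≤ n ≤ N`, one has, for all `h : ℕ` and `0 ≤ j ≤ N`,
`[P j, C^h] = ∑_{n=1}^{min(h, N-j)} (-1)^n n! (h choose n) (N-j choose n) C^{h-n} P (j+n)`. -/
theorem stmt1 (A : Type*) [Ring A] (N : ℕ) (C : A) (P : ℕ → A)
    (hPtop : P (N + 1) = 0)
    (hrel : ∀ n : ℕ, n ≤ N → P n * C - C * P n = -(((N - n : ℕ) : A) * P (n + 1))) :
    ∀ (h : ℕ) (j : ℕ), j ≤ N →
      P j * C ^ h - C ^ h * P j
        = ∑ n ∈ Finset.Icc 1 (min h (N - j)),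
            (-1 : A) ^ n * (n.factorial : A) * (h.choose n : A) * ((N - j).choose n : A)
              * C ^ (h - n) * P (j + n) := by
  intro h j hj
  rw [mul_pow_eq_sum_signedChooseCoeff hrel h (N - j) j (by omega), Finset.range_eq_Ico,
    Finset.sum_eq_sum_Ico_succ_bot (Nat.succ_pos h)]
  simp only [signedChooseCoeff_zero, one_smul, Nat.sub_zero, add_zero, add_sub_cancel_left]
  symm
  refine Finset.sum_subset_zero_on_sdiff (fun n hn => ?_) (fun n hn => ?_) (fun n _ => ?_)
  · simp only [Finset.mem_Icc, Finset.mem_Ico] at hn ⊢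
    omega
  · simp only [Finset.mem_sdiff, Finset.mem_Icc, Finset.mem_Ico] at hn
    rw [signedChooseCoeff_eq_zero_of_lt' (by omega), zero_smul]
  · simp [signedChooseCoeff, zsmul_eq_mul, mul_assoc]
end

section
/- Let A be a unital ring, n ∈ ℕ, and let H, P, Q, Z ∈ A satisfy H·P − P·H = −n·Q, P·Q − Q·P = Z, and Z·P = P·Z, Z·Q = Q·Z. Then for every k ≥ 2: H·P^k − P^k·H = −k·n·P^{k−1}·Q + n·(k(k−1)/2)·Z·P^{k−2}. In particular, in the conformal Galilei algebra with P = P_{ℓ+1/2}, Q = P_{ℓ−1/2}, n = ℓ+1/2 = L+1 and Z = (L+1)!·L!·M, this gives [H, P_{ℓ+1/2}^k] = −k(ℓ+1/2)P_{ℓ+1/2}^{k−1}P_{ℓ−1/2} + (1/2)k(k−1)((ℓ+1/2)!)²·M·P_{ℓ+1/2}^{k−2}, while Z = 0 recovers [H,P_n^k] = −kn P_n^{k−1}P_{n−1} for n ≠ ℓ+1/2. -/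
/-- If `[P, Q] = Z` and `[H, P] = -n Q` with `Z` commuting with `P`, then the commutator of `H`
with a power of `P` has coefficients given by binomial numbers. -/
theorem commutator_pow_add_two {A : Type*} [Ring A] (n : ℕ) (H P Q Z : A)
    (hHP : H * P - P * H = -(n • Q)) (hPQ : P * Q - Q * P = Z) (hZP : Z * P = P * Z) (m : ℕ) :
    H * P ^ (m + 2) - P ^ (m + 2) * H
      = -(((m + 2) * n) • (P ^ (m + 1) * Q)) + (n * (m + 2).choose 2) • (Z * P ^ m) := by
  have hQP : Q * P = P * Q - Z := by rw [← hPQ]; abel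
  have leibniz (k : ℕ) : H * P ^ (k + 1) - P ^ (k + 1) * H
      = (H * P ^ k - P ^ k * H) * P + P ^ k * (H * P - P * H) := by
    rw [pow_succ]; noncomm_ring
  have hQ (k : ℕ) : P ^ k * Q * P = P ^ (k + 1) * Q - Z * P ^ k := by
    have hZ : P ^ k * Z = Z * P ^ k := ((show Commute Z P from hZP).pow_right k).eq.symm
    rw [mul_assoc, hQP, mul_sub, hZ, ← mul_assoc, ← pow_succ]
  induction m with
  | zero =>
    have h := hQ 0
    simp only [pow_zero, one_mul, mul_one, zero_add, pow_one] at h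
    rw [leibniz 1, pow_one, hHP, neg_mul, smul_mul_assoc, h, mul_neg, mul_smul_comm]
    simp only [zero_add, pow_zero, mul_one, Nat.choose_self]
    module
  | succ m ih =>
    have hc : (m + 1 + 2).choose 2 = (m + 2) + (m + 2).choose 2 := by
      rw [show m + 1 + 2 = (m + 2) + 1 from rfl, Nat.choose_succ_succ', Nat.choose_one_right]
    rw [leibniz (m + 2), ih, hHP, add_mul, neg_mul, smul_mul_assoc, smul_mul_assoc, hQ,
      mul_assoc Z, ← pow_succ, mul_neg, mul_smul_comm, hc]
    module

/-- relation (rel-HP) of Lemma 2. In a unital ring `A`, if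
`[H, P] = -n • Q`, `[P, Q] = Z`, and `Z` commutes with `P` and `Q`, then for every
`k ≥ 2`: `[H, P^k] = -k n P^{k-1} Q + n (k(k-1)/2) Z P^{k-2}`.  (Here the
coefficient `k*(k-1)/2` is an exact natural number since `k(k-1)` is even.)
In the conformal Galilei algebra, with `P = P_{ℓ+1/2}`, `Q = P_{ℓ-1/2}`,
`n = ℓ+1/2 = L+1` and `Z = (L+1)! L! M`, this is relation (rel-HP); `Z = 0`
recovers `[H, P_n^k] = -k n P_n^{k-1} P_{n-1}` for `n ≠ ℓ+1/2`. -/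
theorem stmt3 (A : Type*) [Ring A] (n : ℕ) (H P Q Z : A)
    (hHP : H * P - P * H = -((n : A) * Q))
    (hPQ : P * Q - Q * P = Z)
    (hZP : Z * P = P * Z)
    (hZQ : Z * Q = Q * Z) :
    ∀ k : ℕ, 2 ≤ k →
      H * P ^ k - P ^ k * H
        = -((k : A) * (n : A) * P ^ (k - 1) * Q)
            + (n : A) * ((k * (k - 1) / 2 : ℕ) : A) * Z * P ^ (k - 2) := by
  intro k hk
  obtain ⟨m, rfl⟩ := Nat.exists_eq_add_of_le' hk
  rw [commutator_pow_add_two n H P Q Z (by rw [hHP, nsmul_eq_mul]) hPQ hZP m,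
    ← Nat.choose_two_right]
  simp only [nsmul_eq_mul, Nat.cast_mul, mul_assoc, Nat.add_sub_cancel,
    show m + 2 - 1 = m + 1 from rfl]
end

section
/- With the centrally extended conformal Galilei algebra relations in A, fix μ ∈ ℝ, set α := 2(L!)² and K := α·μ·C − P_{L+1}². Then the following commutator identities hold in A: (i) ⁅P_j, K⁆ = −(2L+1−j)·α·μ·P_{j+1} for 0 ≤ j ≤ L−1; (ii) ⁅P_L, K⁆ = (L+1)·α·(M − μ·1)·P_{L+1}; (iii) ⁅H, K⁆ = −α·μ·D + 2(L+1)·P_{L+1}·P_L − ((L+1)!)²·M. -/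
/-- The structure constant `I_a = (-1)^(a+L+1) a! (2L+1-a)!` of the central extension. -/
def cgaI (L a : ℕ) : ℤ := (-1) ^ (a + L + 1) * a.factorial * (2 * L + 1 - a).factorial

/-- At the middle index `a = L`, the structure constant is `-L! (L+1)!`. -/
theorem cgaI_self (L : ℕ) : cgaI L L = -(L.factorial * (L + 1).factorial) := by
  have hodd : (-1 : ℤ) ^ (L + L + 1) = -1 := Odd.neg_one_pow ⟨L, by ring⟩
  have hsub : 2 * L + 1 - L = L + 1 := by omega
  rw [cgaI, hodd, hsub]
  ring

/-- The commutator with `c • z - y ^ 2`, by linearity and the Leibniz rule. -/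
theorem commutator_smul_sub_sq {R A : Type*} [CommRing R] [Ring A] [Algebra R A]
    (c : R) (x y z : A) :
    x * (c • z - y ^ 2) - (c • z - y ^ 2) * x
      = c • (x * z - z * x) - ((x * y - y * x) * y + y * (x * y - y * x)) := by
  rw [mul_sub, sub_mul, mul_smul_comm, smul_mul_assoc, smul_sub]
  noncomm_ring

/-- With the centrally extended conformal Galilei algebra relations
(`ℓ = L + 1/2`), setting `α = 2(L!)²` and `K = α μ C - P_{L+1}²`, the commutators
`[P_j, K]` (for `0 ≤ j ≤ L-1`), `[P_L, K]` and `[H, K]` are as stated in the proof of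
Theorem 1 of the paper. -/
theorem stmt4 (L : ℕ) (A : Type*) [Ring A] [Algebra ℝ A]
    (C D H M : A) (P : ℕ → A) (μ : ℝ)
    (hPtop : P (2 * L + 2) = 0)
    (hMC : M * C = C * M) (hMD : M * D = D * M) (hMH : M * H = H * M)
    (hMP : ∀ n, n ≤ 2 * L + 1 → M * P n = P n * M)
    (hDH : D * H - H * D = 2 * H)
    (hDC : D * C - C * D = -(2 * C))
    (hCH : C * H - H * C = D)
    (hHP0 : H * P 0 - P 0 * H = 0)
    (hHP : ∀ n, 1 ≤ n → n ≤ 2 * L + 1 → H * P n - P n * H = -((n : A) * P (n - 1)))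
    (hDP : ∀ n, n ≤ 2 * L + 1 →
      D * P n - P n * D = (((2 * L + 1 : ℤ) - 2 * (n : ℤ) : ℤ) : A) * P n)
    (hCP : ∀ n, n ≤ 2 * L + 1 →
      C * P n - P n * C = ((2 * L + 1 - n : ℕ) : A) * P (n + 1))
    (hPPcomm : ∀ a b, a ≤ 2 * L + 1 → b ≤ 2 * L + 1 → a + b ≠ 2 * L + 1 →
      P a * P b = P b * P a)
    (hPP : ∀ a, a ≤ 2 * L + 1 →
      P a * P (2 * L + 1 - a) - P (2 * L + 1 - a) * P a = ((cgaI L a : ℤ) : A) * M) :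
    -- `α` and `K`
    let α : ℝ := 2 * (L.factorial : ℝ) ^ 2
    let K : A := (α * μ) • C - P (L + 1) ^ 2
    -- (i)
    (∀ j, j + 1 ≤ L →
      P j * K - K * P j = (-(((2 * L + 1 - j : ℕ) : ℝ) * α * μ)) • P (j + 1)) ∧
    -- (ii)
    (P L * K - K * P L = (((L : ℝ) + 1) * α) • ((M - μ • (1 : A)) * P (L + 1))) ∧
    -- (iii)
    (H * K - K * H
      = -((α * μ) • D) + (2 * ((L : ℝ) + 1)) • (P (L + 1) * P L)
          - (((L + 1).factorial : ℝ) ^ 2) • M) := by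
  intro α K
  have natCast_mul_eq_smul (n : ℕ) (x : A) : (n : A) * x = (n : ℝ) • x := by
    rw [Algebra.smul_def, map_natCast]
  have hPC (n : ℕ) (hn : n ≤ 2 * L + 1) :
      P n * C - C * P n = -(((2 * L + 1 - n : ℕ) : ℝ) • P (n + 1)) := by
    rw [← natCast_mul_eq_smul, ← hCP n hn, neg_sub]
  have hmid : P L * P (L + 1) - P (L + 1) * P L
      = (-((L.factorial : ℝ) * ((L + 1).factorial : ℝ))) • M := by
    have h := hPP L (by omega)
    rw [show 2 * L + 1 - L = L + 1 by omega, cgaI_self] at h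
    rw [h, Algebra.smul_def]
    simp
  have hfact : ((L + 1).factorial : ℝ) = (L + 1) * L.factorial := by
    rw [Nat.factorial_succ]
    push_cast
    ring
  refine ⟨fun j hj => ?_, ?_, ?_⟩
  · rw [commutator_smul_sub_sq, hPC j (by omega),
      hPPcomm j (L + 1) (by omega) (by omega) (by omega)]
    simp only [sub_self, zero_mul, mul_zero, add_zero, sub_zero]
    module
  · rw [commutator_smul_sub_sq, hPC L (by omega), hmid, mul_smul_comm, smul_mul_assoc,
      ← hMP (L + 1) (by omega), sub_mul, smul_mul_assoc, one_mul,
      show 2 * L + 1 - L = L + 1 by omega, hfact]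
    push_cast
    module
  · have hHC : H * C - C * H = -D := by rw [← hCH, neg_sub]
    have hHP' : H * P (L + 1) - P (L + 1) * H = -(((L + 1 : ℕ) : ℝ) • P L) := by
      rw [hHP (L + 1) (by omega) (by omega), natCast_mul_eq_smul, Nat.add_sub_cancel]
    rw [commutator_smul_sub_sq, hHC, hHP', neg_mul, mul_neg, smul_mul_assoc, mul_smul_comm,
      sub_eq_iff_eq_add.mp hmid, hfact]
    push_cast
    module
end

section
/- With the centrally extended conformal Galilei algebra relations in A and a highest weight vector v in an A-module V, set α := 2(L!)². Then for every q ≥ 1: H · ((α·μ·C − P_{L+1}²)^q · v) = −(q/2)·α·μ·( 2δ − 2(q−1) + (L+1)² ) · ((α·μ·C − P_{L+1}²)^{q−1} · v). -/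
/-- Repeated application of `a C - X²` to a highest weight vector `v`: the powers stay eigenvectors
of `M` and `D`, stay annihilated by `Y`, and are lowered by `H`. The condition `a s = 2 b μ`
makes `Y` commute with `a C - X²` on the `μ`-eigenspace of `M`. -/
theorem LinearMap.lowering_pow_apply {V : Type*} [AddCommGroup V] [Module ℝ V]
    (C D H M X Y S : V →ₗ[ℝ] V) (a s b μ δ : ℝ) (v : V)
    (hS : ∀ u, S u = a • C u - X (X u))
    (hMC : ∀ u, M (C u) = C (M u)) (hMX : ∀ u, M (X u) = X (M u))
    (hDC : ∀ u, D (C u) = C (D u) - (2 : ℝ) • C u) (hDX : ∀ u, D (X u) = X (D u) - X u)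
    (hHC : ∀ u, H (C u) = C (H u) - D u) (hHX : ∀ u, H (X u) = X (H u) - s • Y u)
    (hYC : ∀ u, Y (C u) = C (Y u) - s • X u) (hYX : ∀ u, Y (X u) = X (Y u) - b • M u)
    (ha : a * s = 2 * b * μ)
    (hDv : D v = δ • v) (hMv : M v = μ • v) (hHv : H v = 0) (hYv : Y v = 0) (q : ℕ) :
    M ((S ^ q) v) = μ • (S ^ q) v ∧ Y ((S ^ q) v) = 0 ∧
      D ((S ^ q) v) = (δ - 2 * q) • (S ^ q) v ∧
      H ((S ^ (q + 1)) v) =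
        (-((q + 1) * (a * (δ - q) + s * b * μ))) • (S ^ q) v := by
  have step (q : ℕ) (u : V) (hM : M u = μ • u) (hY : Y u = 0) (hD : D u = (δ - 2 * q) • u) :
      M (S u) = μ • S u ∧ Y (S u) = 0 ∧ D (S u) = (δ - 2 * (q + 1)) • S u ∧
      H (S u) = S (H u) - (a * (δ - 2 * q) + s * b * μ) • u := by
    refine ⟨?_, ?_, ?_, ?_⟩
    · simp only [hS, map_sub, map_smul, hMC, hMX, hM]
      module
    · simp only [hS, map_sub, map_smul, hYC, hYX, hMX, hM, hY, map_zero]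
      match_scalars
      linear_combination -ha
    · simp only [hS, map_sub, map_smul, hDC, hDX, hD]
      module
    · simp only [hS, map_sub, map_smul, hHC, hHX, hYX, hM, hY, hD, map_zero]
      module
  induction q with
  | zero =>
    have h := step 0 v hMv hYv (by simpa using hDv)
    refine ⟨by simpa using hMv, by simpa using hYv, by simpa using hDv, ?_⟩
    rw [zero_add, pow_one, h.2.2.2, hHv, pow_zero, Module.End.one_apply, map_zero]
    push_cast
    module
  | succ q ih =>
    obtain ⟨hM, hY, hD, hH⟩ := ih
    obtain ⟨hM', hY', hD', -⟩ := step q _ hM hY hD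
    have hpow (k : ℕ) : S ((S ^ k) v) = (S ^ (k + 1)) v := by
      rw [pow_succ', Module.End.mul_apply]
    rw [hpow] at hM' hY' hD'
    have hD'' : D ((S ^ (q + 1)) v) = (δ - 2 * ((q + 1 : ℕ) : ℝ)) • (S ^ (q + 1)) v := by
      simpa using hD'
    have hH' := (step (q + 1) _ hM' hY' hD'').2.2.2
    refine ⟨hM', hY', hD'', ?_⟩
    rw [← hpow (q + 1), hH', hH, map_smul, hpow]
    push_cast
    module

/-- With the centrally extended conformal Galilei algebra relations and
a highest weight vector `v`, for every `q ≥ 1`,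
`H • ((αμC - P_{L+1}²)^q • v) = -(q/2) α μ (2δ - 2(q-1) + (L+1)²) • ((αμC - P_{L+1}²)^{q-1} • v)`
where `α = 2(L!)²`. -/
theorem stmt6 (L : ℕ) (A : Type*) [Ring A] [Algebra ℝ A]
    (C D H M : A) (P : ℕ → A)
    (V : Type*) [AddCommGroup V] [Module ℝ V] [Module A V] [IsScalarTower ℝ A V]
    (v : V) (δ μ : ℝ)
    (hPtop : P (2 * L + 2) = 0)
    (hMC : M * C = C * M) (hMD : M * D = D * M) (hMH : M * H = H * M)
    (hMP : ∀ n, n ≤ 2 * L + 1 → M * P n = P n * M)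
    (hDH : D * H - H * D = 2 * H)
    (hDC : D * C - C * D = -(2 * C))
    (hCH : C * H - H * C = D)
    (hHP0 : H * P 0 - P 0 * H = 0)
    (hHP : ∀ n, 1 ≤ n → n ≤ 2 * L + 1 → H * P n - P n * H = -((n : A) * P (n - 1)))
    (hDP : ∀ n, n ≤ 2 * L + 1 →
      D * P n - P n * D = (((2 * L + 1 : ℤ) - 2 * (n : ℤ) : ℤ) : A) * P n)
    (hCP : ∀ n, n ≤ 2 * L + 1 →
      C * P n - P n * C = ((2 * L + 1 - n : ℕ) : A) * P (n + 1))
    (hPPcomm : ∀ a b, a ≤ 2 * L + 1 → b ≤ 2 * L + 1 → a + b ≠ 2 * L + 1 →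
      P a * P b = P b * P a)
    (hPP : ∀ a, a ≤ 2 * L + 1 →
      P a * P (2 * L + 1 - a) - P (2 * L + 1 - a) * P a = ((cgaI L a : ℤ) : A) * M)
    (hDv : D • v = δ • v) (hMv : M • v = μ • v) (hHv : H • v = (0 : V))
    (hPv : ∀ n, n ≤ L → P n • v = 0) :
    ∀ q : ℕ, 1 ≤ q →
      H • ((((2 * (L.factorial : ℝ) ^ 2) * μ) • C - P (L + 1) ^ 2) ^ q • v)
        = (-((q : ℝ) / 2 * (2 * (L.factorial : ℝ) ^ 2) * μ
              * (2 * δ - 2 * ((q : ℝ) - 1) + ((L : ℝ) + 1) ^ 2)))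
            • ((((2 * (L.factorial : ℝ) ^ 2) * μ) • C - P (L + 1) ^ 2) ^ (q - 1) • v) := by
  intro q hq
  obtain ⟨q, rfl⟩ := Nat.exists_eq_add_of_le' hq
  have hX : L + 1 ≤ 2 * L + 1 := by lia
  have hY : L ≤ 2 * L + 1 := by lia
  have hHX := hHP (L + 1) (by lia) hX
  have hDX := hDP (L + 1) hX
  have hCY := hCP L hY
  have hYX := hPP L hY
  rw [show 2 * L + 1 - L = L + 1 by lia] at hCY hYX
  have hI : cgaI L L = -((L.factorial * (L + 1).factorial : ℕ) : ℤ) := by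
    rw [cgaI, show 2 * L + 1 - L = L + 1 by lia, Odd.neg_one_pow ⟨L, by ring⟩]
    push_cast
    ring
  rw [hI] at hYX
  rw [show ((2 * L + 1 : ℤ) - 2 * ((L + 1 : ℕ) : ℤ)) = -1 by push_cast; ring] at hDX
  rw [Nat.add_sub_cancel] at hHX
  have hcast (n : ℕ) (x : A) (u : V) : ((n : A) * x) • u = (n : ℝ) • x • u := by
    rw [← nsmul_eq_mul, smul_assoc, Nat.cast_smul_eq_nsmul]
  have swap {x y z : A} (h : x * y - y * x = z) (u : V) : x • y • u = y • x • u + z • u := by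
    rw [smul_smul, smul_smul, ← h, sub_smul, add_sub_cancel]
  let ρ := Algebra.lsmul ℝ ℝ V (A := A)
  set a : ℝ := 2 * (L.factorial : ℝ) ^ 2 * μ with ha
  have h := LinearMap.lowering_pow_apply (ρ C) (ρ D) (ρ H) (ρ M) (ρ (P (L + 1))) (ρ (P L))
    (ρ (a • C - P (L + 1) ^ 2)) a ((L + 1 : ℕ) : ℝ)
    ((L.factorial * (L + 1).factorial : ℕ) : ℝ) μ δ v
    (fun u => by simp [ρ, pow_two])
    (fun u => by simp [ρ, smul_smul, hMC])
    (fun u => by simp [ρ, smul_smul, hMP _ hX])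
    (fun u => by
      have := hcast 2 C u
      simp only [Nat.cast_ofNat] at this
      simp only [ρ, Algebra.lsmul_coe]
      rw [swap hDC, neg_smul, this, sub_eq_add_neg])
    (fun u => by
      simp only [ρ, Algebra.lsmul_coe]
      rw [swap hDX]
      simp [sub_eq_add_neg])
    (fun u => by
      simp only [ρ, Algebra.lsmul_coe]
      rw [swap hCH, add_sub_cancel_right])
    (fun u => by
      simp only [ρ, Algebra.lsmul_coe]
      rw [swap hHX, neg_smul, hcast, sub_eq_add_neg])
    (fun u => by
      simp only [ρ, Algebra.lsmul_coe]
      rw [swap hCY, hcast, add_sub_cancel_right])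
    (fun u => by
      simp only [ρ, Algebra.lsmul_coe]
      rw [swap hYX, Int.cast_neg, Int.cast_natCast, neg_mul, neg_smul, hcast, sub_eq_add_neg])
    (by rw [ha, Nat.factorial_succ]; push_cast; ring)
    hDv hMv hHv (hPv L le_rfl) q
  have hH := h.2.2.2
  rw [← map_pow, ← map_pow] at hH
  simp only [ρ, Algebra.lsmul_coe] at hH
  rw [Nat.add_sub_cancel, hH]
  congr 1
  rw [ha, Nat.factorial_succ]
  push_cast
  ring
end

section
/- (Theorem 1) With the centrally extended conformal Galilei algebra relations in A and a highest weight vector v in an A-module V, set α := 2(L!)². Suppose q ≥ 1 and 2δ − 2(q−1) + (L+1)² = 0. Then the vector u := (α·μ·C − P_{L+1}²)^q · v is a singular vector at level 2q, i.e. it satisfies: D·u = (δ − 2q)·u, M·u = μ·u, H·u = 0, and P_j·u = 0 for all 0 ≤ j ≤ L. -/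
/-- If `X * Y - Y * X = Z`, then `X` can be moved past `Y` when acting on a vector. -/
lemma smul_smul_of_commutator {A V : Type*} [Ring A] [AddCommGroup V] [Module A V]
    {X Y Z : A} (h : X * Y - Y * X = Z) (w : V) : X • Y • w = Y • X • w + Z • w := by
  rw [← h, sub_smul, mul_smul, mul_smul, add_sub_cancel]

/-- One step of the recursion: how `H`, `D`, `M` and `R` act on `S x = a • C x - Q (Q x)`, when `x`
is an eigenvector of `D` and `M` that is killed by `R`. -/
lemma singular_vector_step {V : Type*} [AddCommGroup V] [Module ℝ V]
    {C D H M Q R S : Module.End ℝ V} {a b c m μ d : ℝ}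
    (hS : ∀ x, S x = a • C x - Q (Q x))
    (hMC : ∀ x, M (C x) = C (M x)) (hMQ : ∀ x, M (Q x) = Q (M x))
    (hDC : ∀ x, D (C x) = C (D x) - (2 : ℝ) • C x) (hDQ : ∀ x, D (Q x) = Q (D x) - Q x)
    (hHC : ∀ x, H (C x) = C (H x) - D x) (hHQ : ∀ x, H (Q x) = Q (H x) - m • R x)
    (hRC : ∀ x, R (C x) = C (R x) - m • Q x) (hRQ : ∀ x, R (Q x) = Q (R x) - b • M x)
    (hab : a * m = 2 * b * μ) (hc : c = a * d + m * b * μ)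
    {x : V} (hD : D x = d • x) (hM : M x = μ • x) (hR : R x = 0) :
    D (S x) = (d - 2) • S x ∧ M (S x) = μ • S x ∧ R (S x) = 0 ∧
      H (S x) = S (H x) - c • x := by
  refine ⟨?_, ?_, ?_, ?_⟩
  · simp only [hS, map_sub, map_smul, hDC, hDQ, hD]
    module
  · simp only [hS, map_sub, map_smul, hMC, hMQ, hM]
    module
  · simp only [hS, map_sub, map_smul, hRC, hRQ, hMQ, hM, hR, map_zero]
    rw [zero_sub, zero_sub, smul_neg, smul_smul, hab]
    module
  · simp only [hS, map_sub, map_smul, hHC, hHQ, hRQ, hD, hM, hR, map_zero, hc]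
    module

/-- Theorem 1 of the paper. With the centrally extended conformal
Galilei algebra relations and a highest weight vector `v`, if `q ≥ 1` and
`2δ - 2(q-1) + (L+1)² = 0`, then `u = (αμC - P_{L+1}²)^q • v` (with `α = 2(L!)²`)
is a singular vector at level `2q`:
`D•u = (δ-2q)•u`, `M•u = μ•u`, `H•u = 0`, and `P j • u = 0` for `0 ≤ j ≤ L`. -/
theorem stmt7 (L : ℕ) (A : Type*) [Ring A] [Algebra ℝ A]
    (C D H M : A) (P : ℕ → A)
    (V : Type*) [AddCommGroup V] [Module ℝ V] [Module A V] [IsScalarTower ℝ A V]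
    (v : V) (δ μ : ℝ)
    (hPtop : P (2 * L + 2) = 0)
    (hMC : M * C = C * M) (hMD : M * D = D * M) (hMH : M * H = H * M)
    (hMP : ∀ n, n ≤ 2 * L + 1 → M * P n = P n * M)
    (hDH : D * H - H * D = 2 * H)
    (hDC : D * C - C * D = -(2 * C))
    (hCH : C * H - H * C = D)
    (hHP0 : H * P 0 - P 0 * H = 0)
    (hHP : ∀ n, 1 ≤ n → n ≤ 2 * L + 1 → H * P n - P n * H = -((n : A) * P (n - 1)))
    (hDP : ∀ n, n ≤ 2 * L + 1 →
      D * P n - P n * D = (((2 * L + 1 : ℤ) - 2 * (n : ℤ) : ℤ) : A) * P n)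
    (hCP : ∀ n, n ≤ 2 * L + 1 →
      C * P n - P n * C = ((2 * L + 1 - n : ℕ) : A) * P (n + 1))
    (hPPcomm : ∀ a b, a ≤ 2 * L + 1 → b ≤ 2 * L + 1 → a + b ≠ 2 * L + 1 →
      P a * P b = P b * P a)
    (hPP : ∀ a, a ≤ 2 * L + 1 →
      P a * P (2 * L + 1 - a) - P (2 * L + 1 - a) * P a = ((cgaI L a : ℤ) : A) * M)
    (hDv : D • v = δ • v) (hMv : M • v = μ • v) (hHv : H • v = (0 : V))
    (hPv : ∀ n, n ≤ L → P n • v = 0)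
    (q : ℕ) (hq : 1 ≤ q)
    (hδ : 2 * δ - 2 * ((q : ℝ) - 1) + ((L : ℝ) + 1) ^ 2 = 0) :
    let u : V := (((2 * (L.factorial : ℝ) ^ 2) * μ) • C - P (L + 1) ^ 2) ^ q • v
    D • u = (δ - 2 * (q : ℝ)) • u ∧
    M • u = μ • u ∧
    H • u = 0 ∧
    ∀ j, j ≤ L → P j • u = 0 := by
  intro u
  have hcomm : SMulCommClass A ℝ V := IsScalarTower.to_smulCommClass'
  let T : A →+* Module.End ℝ V := (Algebra.lsmul ℝ ℝ V).toRingHom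
  have hnat (n : ℕ) (X : A) (w : V) : ((n : A) * X) • w = (n : ℝ) • X • w := by
    rw [mul_smul, Nat.cast_smul_eq_nsmul, Nat.cast_smul_eq_nsmul]
  have hint (n : ℤ) (X : A) (w : V) : ((n : A) * X) • w = (n : ℝ) • X • w := by
    rw [mul_smul, Int.cast_smul_eq_zsmul, Int.cast_smul_eq_zsmul]
  set a : ℝ := 2 * (L.factorial : ℝ) ^ 2 * μ with ha
  set S : A := a • C - P (L + 1) ^ 2 with hSdef
  have hS (w : V) : S • w = a • C • w - P (L + 1) • P (L + 1) • w := by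
    rw [hSdef, sub_smul, smul_assoc, pow_two, mul_smul (P (L + 1))]
  have hcga : cgaI L L = -((L.factorial * (L + 1).factorial : ℕ) : ℤ) := by
    have h : 2 * L + 1 - L = L + 1 := by lia
    rw [cgaI, h, Odd.neg_one_pow ⟨L, by ring⟩]
    push_cast
    ring
  have hPC {j : ℕ} (hj : j ≤ L) (w : V) :
      P j • C • w = C • P j • w - (2 * L + 1 - j : ℝ) • P (j + 1) • w := by
    have h := smul_smul_of_commutator (hCP j (by lia)) w
    rw [hnat, Nat.cast_sub (by lia)] at h
    rw [h]
    generalize P j • C • w = x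
    generalize P (j + 1) • w = y
    push_cast
    module
  have step (d : ℝ) {w : V} (hD : D • w = d • w) (hM : M • w = μ • w) (hR : P L • w = 0) :
      D • S • w = (d - 2) • S • w ∧ M • S • w = μ • S • w ∧ P L • S • w = 0 ∧
        H • S • w = S • H • w
          - ((L.factorial : ℝ) ^ 2 * μ * (2 * d + ((L : ℝ) + 1) ^ 2)) • w := by
    refine singular_vector_step (C := T C) (D := T D) (H := T H) (M := T M) (Q := T (P (L + 1)))
      (R := T (P L)) (S := T S) (a := a) (m := L + 1)
      (b := (L.factorial * (L + 1).factorial : ℕ)) hS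
      (fun x ↦ ?_) (fun x ↦ ?_) (fun x ↦ ?_) (fun x ↦ ?_) (fun x ↦ ?_) (fun x ↦ ?_)
      (fun x ↦ ?_) (fun x ↦ ?_) ?_ ?_ hD hM hR
    · change M • C • x = C • M • x
      rw [smul_smul, hMC, mul_smul]
    · change M • P (L + 1) • x = P (L + 1) • M • x
      rw [smul_smul, hMP _ (by lia), mul_smul]
    · change D • C • x = C • D • x - (2 : ℝ) • C • x
      rw [smul_smul_of_commutator hDC, neg_smul, ← sub_eq_add_neg]
      exact_mod_cast congrArg _ (hnat 2 C x)
    · change D • P (L + 1) • x = P (L + 1) • D • x - P (L + 1) • x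
      rw [smul_smul_of_commutator (hDP (L + 1) (by lia)), hint]
      generalize P (L + 1) • D • x = y
      generalize P (L + 1) • x = z
      push_cast
      module
    · change H • C • x = C • H • x - D • x
      rw [smul_smul_of_commutator hCH, add_sub_cancel_right]
    · change H • P (L + 1) • x = P (L + 1) • H • x - ((L : ℝ) + 1) • P L • x
      rw [smul_smul_of_commutator (hHP (L + 1) (by lia) (by lia)), neg_smul, hnat,
        ← sub_eq_add_neg]
      push_cast
      rfl
    · change P L • C • x = C • P L • x - ((L : ℝ) + 1) • P (L + 1) • x
      rw [hPC le_rfl]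
      congr 2
      ring
    · change P L • P (L + 1) • x = P (L + 1) • P L • x - _ • M • x
      have h := hPP L (by lia)
      rw [show 2 * L + 1 - L = L + 1 by lia] at h
      rw [smul_smul_of_commutator h, hint, hcga, Int.cast_neg, Int.cast_natCast, neg_smul,
        ← sub_eq_add_neg]
    · rw [ha, Nat.factorial_succ]
      push_cast
      ring
    · rw [ha, Nat.factorial_succ]
      push_cast
      ring
  have hPS {j : ℕ} (hj : j < L) (w : V) :
      P j • S • w = S • P j • w - (a * (2 * L + 1 - j)) • P (j + 1) • w := by
    have hQ (x : V) : P j • P (L + 1) • x = P (L + 1) • P j • x := by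
      rw [smul_smul, hPPcomm j (L + 1) (by lia) (by lia) (by lia), mul_smul]
    rw [hS, hS, smul_sub, smul_comm (P j) a, hPC hj.le, hQ, hQ, smul_sub, smul_smul a]
    exact sub_right_comm _ _ _
  have eigen (k : ℕ) : D • S ^ k • v = (δ - 2 * (k : ℝ)) • S ^ k • v ∧
      M • S ^ k • v = μ • S ^ k • v ∧ ∀ j ≤ L, P j • S ^ k • v = 0 := by
    induction k with
    | zero => simpa using ⟨hDv, hMv, hPv⟩
    | succ k ih =>
      obtain ⟨hD, hM, hP⟩ := ih
      obtain ⟨hD', hM', hP', -⟩ := step _ hD hM (hP L le_rfl)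
      rw [pow_succ', mul_smul]
      refine ⟨?_, hM', fun j hj ↦ ?_⟩
      · rw [hD']
        push_cast
        congr 1
        ring
      · obtain rfl | hj := hj.eq_or_lt
        · exact hP'
        · rw [hPS hj, hP j hj.le, hP (j + 1) hj, smul_zero, smul_zero, sub_zero]
  have raise (k : ℕ) : H • S ^ (k + 1) • v =
      (-((L.factorial : ℝ) ^ 2 * μ * (k + 1) * (2 * δ - 2 * k + ((L : ℝ) + 1) ^ 2))) •
        S ^ k • v := by
    induction k with
    | zero =>
      obtain ⟨hD, hM, hP⟩ := eigen 0
      rw [pow_succ', mul_smul, (step _ hD hM (hP L le_rfl)).2.2.2, pow_zero, one_smul, hHv,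
        smul_zero, zero_sub, ← neg_smul]
      congr 1
      push_cast
      ring
    | succ k ih =>
      obtain ⟨hD, hM, hP⟩ := eigen (k + 1)
      rw [pow_succ', mul_smul, (step _ hD hM (hP L le_rfl)).2.2.2, ih, smul_comm S,
        ← mul_smul S, ← pow_succ', ← sub_smul]
      congr 1
      push_cast
      ring
  obtain ⟨hD, hM, hP⟩ := eigen q
  refine ⟨hD, hM, ?_, hP⟩
  obtain ⟨k, rfl⟩ := Nat.exists_eq_add_of_le' hq
  have h0 : 2 * δ - 2 * (k : ℝ) + ((L : ℝ) + 1) ^ 2 = 0 := by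
    push_cast at hδ
    linarith
  change H • S ^ (k + 1) • v = 0
  rw [raise, h0, mul_zero, neg_zero, zero_smul]
end

section
/- (Lemma 3, H-action) With the centrally extended conformal Galilei algebra relations in A and a highest weight vector v in an A-module V, for (h, k_0, …, k_L) ∈ ℕ^{L+2} let |h,k⟩ := C^h·P_{L+1}^{k_0}·P_{L+2}^{k_1}⋯P_{2L+1}^{k_L}·v and m := 2h + Σ_{j=0}^{L}(2j+1)k_j. Then H·|h,k⟩ = h·(m − h − δ − 1)·|h−1; k_0,…,k_L⟩ + (1/2)·k_0·(k_0−1)·((L+1)!)²·μ·|h; k_0−2, k_1,…,k_L⟩ − Σ_{j=1}^{L} k_j·(L+1+j)·|h; k_0,…,k_{j−1}+1, k_j−1,…,k_L⟩, where any term whose scalar coefficient is zero is interpreted as 0 (so no negative exponents occur). -/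
section CommutatorPowers

variable {A : Type*} [Ring A]

/-- The ordered product `x 0 ^ k 0 * ⋯ * x (n - 1) ^ k (n - 1)`. -/
def ordProd (x : ℕ → A) (k : ℕ → ℕ) (n : ℕ) : A :=
  ((List.range n).map fun j => x j ^ k j).prod

theorem ordProd_succ (x : ℕ → A) (k : ℕ → ℕ) (n : ℕ) :
    ordProd x k (n + 1) = ordProd x k n * x n ^ k n := by
  simp [ordProd, List.range_succ]

theorem ordProd_congr (x : ℕ → A) {k k' : ℕ → ℕ} {n : ℕ} (h : ∀ j < n, k j = k' j) :
    ordProd x k n = ordProd x k' n := by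
  unfold ordProd
  congr 1
  refine List.map_congr_left fun j hj => ?_
  rw [h j (List.mem_range.mp hj)]

theorem ordProd_update_of_le (x : ℕ → A) (k : ℕ → ℕ) {n i : ℕ} (a : ℕ) (h : n ≤ i) :
    ordProd x (Function.update k i a) n = ordProd x k n :=
  ordProd_congr x fun j hj => Function.update_of_ne (by omega) _ _

theorem ordProd_update_mul_pow (x : ℕ → A) (k : ℕ → ℕ) {n i : ℕ} (a : ℕ) (h : i < n) :
    ordProd x (Function.update k i a) n * x n ^ k n
      = ordProd x (Function.update k i a) (n + 1) := by
  rw [ordProd_succ, Function.update_of_ne (by omega)]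

variable [Algebra ℝ A]

/-- Moving `H` past a power of `x` when `[H, x] = -c y` and `[y, x] = d z` with `z` commuting
with `x`. -/
theorem mul_pow_of_commutators {H x y z : A} {c d : ℝ} (hx : H * x = x * H - c • y)
    (hy : y * x = x * y + d • z) (hz : z * x = x * z) (k : ℕ) :
    H * x ^ k = x ^ k * H - ((k : ℝ) * c) • (x ^ (k - 1) * y)
      - ((k : ℝ) * ((k : ℝ) - 1) / 2 * c * d) • (x ^ (k - 2) * z) := by
  induction k with
  | zero => simp
  | succ k ih =>
    rw [pow_succ, ← mul_assoc, ih]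
    simp only [sub_mul, smul_mul_assoc, mul_assoc, hx, hy, hz]
    rcases k with _ | _ | k
    · simp [mul_add, mul_sub]
    · simp [mul_add, mul_sub, pow_succ]
      module
    · have h1 : k + 1 + 1 - 1 = k + 1 := rfl
      have h2 : k + 1 + 1 - 2 = k := rfl
      have h3 : k + 1 + 1 + 1 - 1 = k + 2 := rfl
      have h4 : k + 1 + 1 + 1 - 2 = k + 1 := rfl
      simp only [h1, h2, h3, h4, mul_add, mul_sub, pow_succ, mul_assoc, mul_smul_comm]
      push_cast
      module

theorem mul_pow_of_eigen {D x : A} {c : ℝ} (hx : D * x = x * D + c • x) (k : ℕ) :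
    D * x ^ k = x ^ k * D + ((k : ℝ) * c) • x ^ k := by
  induction k with
  | zero => simp
  | succ k ih =>
    rw [pow_succ, ← mul_assoc, ih, add_mul, mul_assoc, hx]
    simp only [mul_add, smul_mul_assoc, mul_smul_comm, mul_assoc]
    push_cast
    module

theorem eigen_mul_ordProd {D : A} {x : ℕ → A} {c : ℕ → ℝ} (k : ℕ → ℕ) (n : ℕ)
    (hx : ∀ j < n, D * x j = x j * D + c j • x j) :
    D * ordProd x k n
      = ordProd x k n * D + (∑ j ∈ Finset.range n, (k j : ℝ) * c j) • ordProd x k n := by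
  induction n with
  | zero => simp [ordProd]
  | succ n ih =>
    rw [ordProd_succ, ← mul_assoc, ih fun j hj => hx j (by omega), add_mul, mul_assoc,
      mul_pow_of_eigen (hx n (by omega)), Finset.sum_range_succ]
    simp only [mul_add, smul_mul_assoc, mul_smul_comm, mul_assoc]
    module

/-- Moving `H` past an ordered product when `H` lowers `x (j + 1)` to `x j` and `x 0` to `y`,
where `[y, x 0] = d z`. -/
theorem lowering_mul_ordProd {H y z : A} {x : ℕ → A} {c : ℕ → ℝ} {d : ℝ} (k : ℕ → ℕ) (n : ℕ)
    (hx0 : H * x 0 = x 0 * H - c 0 • y)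
    (hx : ∀ j < n, H * x (j + 1) = x (j + 1) * H - c (j + 1) • x j)
    (hxx : ∀ j < n, x j * x (j + 1) = x (j + 1) * x j)
    (hy0 : y * x 0 = x 0 * y + d • z)
    (hy : ∀ j < n, Commute y (x (j + 1)))
    (hz : ∀ j ≤ n, Commute z (x j)) :
    H * ordProd x k (n + 1) = ordProd x k (n + 1) * H
      - ((k 0 : ℝ) * c 0) • (ordProd x (Function.update k 0 (k 0 - 1)) (n + 1) * y)
      - ((k 0 : ℝ) * ((k 0 : ℝ) - 1) / 2 * c 0 * d)
          • (ordProd x (Function.update k 0 (k 0 - 2)) (n + 1) * z)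
      - ∑ j ∈ Finset.Icc 1 n, ((k j : ℝ) * c j)
          • ordProd x (Function.update (Function.update k j (k j - 1)) (j - 1)
              (k (j - 1) + 1)) (n + 1) := by
  induction n with
  | zero =>
    simpa [ordProd] using mul_pow_of_commutators hx0 hy0 (hz 0 le_rfl) (k 0)
  | succ n ih =>
    have hpow := mul_pow_of_commutators (z := 0) (d := 0) (hx n (by omega))
      (by simpa using hxx n (by omega)) (by simp) (k (n + 1))
    have hlast : ordProd x k (n + 1) * (x (n + 1) ^ (k (n + 1) - 1) * x n)
        = ordProd x (Function.update (Function.update k (n + 1) (k (n + 1) - 1)) n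
              (k n + 1)) (n + 1 + 1) := by
      rw [ordProd_succ x _ (n + 1), ordProd_succ x _ n, ordProd_succ x _ n,
        ordProd_update_of_le _ _ _ le_rfl, ordProd_update_of_le _ _ _ (by omega),
        ← (show Commute (x n) (x (n + 1)) from hxx n (by omega)).pow_right _]
      simp [pow_succ, mul_assoc]
    have hsum : (∑ j ∈ Finset.Icc 1 n, ((k j : ℝ) * c j)
          • ordProd x (Function.update (Function.update k j (k j - 1)) (j - 1)
              (k (j - 1) + 1)) (n + 1)) * x (n + 1) ^ k (n + 1)
        = ∑ j ∈ Finset.Icc 1 n, ((k j : ℝ) * c j)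
          • ordProd x (Function.update (Function.update k j (k j - 1)) (j - 1)
              (k (j - 1) + 1)) (n + 1 + 1) := by
      rw [Finset.sum_mul]
      refine Finset.sum_congr rfl fun j hj => ?_
      rw [Finset.mem_Icc] at hj
      rw [smul_mul_assoc, ordProd_succ x _ (n + 1), Function.update_of_ne (by omega),
        Function.update_of_ne (by omega)]
    rw [ordProd_succ x k, ← mul_assoc, ih (fun j hj => hx j (by omega))
      (fun j hj => hxx j (by omega)) (fun j hj => hy j (by omega)) (fun j hj => hz j (by omega)),
      sub_mul, sub_mul, sub_mul, hsum, mul_assoc _ H, hpow, Finset.sum_Icc_succ_top (by omega),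
      smul_mul_assoc, smul_mul_assoc, mul_assoc _ y, mul_assoc _ z,
      (hy n (by omega)).pow_right _, (hz (n + 1) le_rfl).pow_right _,
      ← mul_assoc _ _ y, ← mul_assoc _ _ z, ordProd_update_mul_pow _ _ _ (by omega),
      ordProd_update_mul_pow _ _ _ (by omega), Nat.add_sub_cancel, ← hlast]
    simp only [mul_sub, mul_smul_comm, mul_zero, smul_zero, sub_zero, mul_assoc]
    abel

end CommutatorPowers


/-- The basis vector `|h,k⟩ = C^h P_{L+1}^{k 0} P_{L+2}^{k 1} ⋯ P_{2L+1}^{k L} • v`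
of the Verma module. -/
def ket (L : ℕ) {A : Type*} [Ring A] {V : Type*} [AddCommGroup V] [Module A V]
    (C : A) (P : ℕ → A) (v : V) (h : ℕ) (k : ℕ → ℕ) : V :=
  (C ^ h * ((List.range (L + 1)).map fun j => P (L + 1 + j) ^ k j).prod) • v

/-- Lemma 3, `H`-action.  With the centrally extended conformal
Galilei algebra relations and highest weight vector `v`, the action of `H` on the
basis vector `|h,k⟩` of level `m = 2h + ∑_{j=0}^{L} (2j+1) k_j` is
`H|h,k⟩ = h(m-h-δ-1)|h-1,k⟩ + ½ k₀(k₀-1)((L+1)!)² μ |h,k₀-2⟩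
  - ∑_{j=1}^{L} k_j (L+1+j) |h, k+e_{j-1}-e_j⟩`,
terms with vanishing scalar coefficient being interpreted as `0` (truncated
natural subtraction in the labels is thus harmless). -/
theorem stmt8 (L : ℕ) (A : Type*) [Ring A] [Algebra ℝ A]
    (C D H M : A) (P : ℕ → A)
    (V : Type*) [AddCommGroup V] [Module ℝ V] [Module A V] [IsScalarTower ℝ A V]
    (v : V) (δ μ : ℝ)
    (hPtop : P (2 * L + 2) = 0)
    (hMC : M * C = C * M) (hMD : M * D = D * M) (hMH : M * H = H * M)
    (hMP : ∀ n, n ≤ 2 * L + 1 → M * P n = P n * M)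
    (hDH : D * H - H * D = 2 * H)
    (hDC : D * C - C * D = -(2 * C))
    (hCH : C * H - H * C = D)
    (hHP0 : H * P 0 - P 0 * H = 0)
    (hHP : ∀ n, 1 ≤ n → n ≤ 2 * L + 1 → H * P n - P n * H = -((n : A) * P (n - 1)))
    (hDP : ∀ n, n ≤ 2 * L + 1 →
      D * P n - P n * D = (((2 * L + 1 : ℤ) - 2 * (n : ℤ) : ℤ) : A) * P n)
    (hCP : ∀ n, n ≤ 2 * L + 1 →
      C * P n - P n * C = ((2 * L + 1 - n : ℕ) : A) * P (n + 1))
    (hPPcomm : ∀ a b, a ≤ 2 * L + 1 → b ≤ 2 * L + 1 → a + b ≠ 2 * L + 1 →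
      P a * P b = P b * P a)
    (hPP : ∀ a, a ≤ 2 * L + 1 →
      P a * P (2 * L + 1 - a) - P (2 * L + 1 - a) * P a = ((cgaI L a : ℤ) : A) * M)
    (hDv : D • v = δ • v) (hMv : M • v = μ • v) (hHv : H • v = (0 : V))
    (hPv : ∀ n, n ≤ L → P n • v = 0) :
    ∀ (h : ℕ) (k : ℕ → ℕ),
      H • ket L C P v h k
        = ((h : ℝ) * (((2 * h + ∑ j ∈ Finset.range (L + 1), (2 * j + 1) * k j : ℕ) : ℝ)
              - (h : ℝ) - δ - 1)) • ket L C P v (h - 1) k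
          + ((1 / 2 : ℝ) * (k 0 : ℝ) * ((k 0 : ℝ) - 1) * ((L + 1).factorial : ℝ) ^ 2 * μ)
              • ket L C P v h (Function.update k 0 (k 0 - 2))
          - ∑ j ∈ Finset.Icc 1 L,
              ((k j : ℝ) * ((L : ℝ) + 1 + (j : ℝ)))
                • ket L C P v h
                    (Function.update (Function.update k j (k j - 1)) (j - 1)
                      (k (j - 1) + 1)) := by
  intro h k
  let x : ℕ → A := fun j => P (L + 1 + j)
  have ket_eq (h : ℕ) (k : ℕ → ℕ) : ket L C P v h k = (C ^ h * ordProd x k (L + 1)) • v := rfl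
  have hHx (n : ℕ) (hn : n ≤ L) :
      H * P (L + 1 + n) = P (L + 1 + n) * H - ((L : ℝ) + 1 + (n : ℝ)) • P (L + n) := by
    have := hHP (L + 1 + n) (by omega) (by omega)
    rw [show L + 1 + n - 1 = L + n by omega] at this
    rw [Algebra.smul_def, sub_eq_add_neg, ← sub_eq_iff_eq_add', this]
    simp
  have hDx : ∀ j < L + 1, D * x j = x j * D + (-(2 * (j : ℝ) + 1)) • x j := by
    intro j hj
    have := hDP (L + 1 + j) (by omega)
    have hcast : -(2 * (j : ℝ) + 1) = ((2 * L + 1 - 2 * ((L + 1 + j : ℕ) : ℤ) : ℤ) : ℝ) := by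
      push_cast
      ring
    rw [Algebra.smul_def, ← sub_eq_iff_eq_add', this, hcast, map_intCast]
  have hbase : P L * x 0 = x 0 * P L + (-((L.factorial : ℝ) * (L + 1).factorial)) • M := by
    have := hPP L (by omega)
    rw [show 2 * L + 1 - L = L + 1 by omega] at this
    rw [Algebra.smul_def, ← sub_eq_iff_eq_add']
    refine this.trans ?_
    congr 1
    have hodd : Odd (L + L + 1) := ⟨L, by ring⟩
    simp [cgaI, hodd.neg_one_pow, show 2 * L + 1 - L = L + 1 by omega]
  have hC := mul_pow_of_commutators (H := H) (x := C) (y := D) (z := C) (c := 1) (d := -2)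
    (by rw [one_smul, ← hCH]; abel)
    (by rw [← sub_eq_iff_eq_add', hDC, neg_smul, two_smul, two_mul]) rfl h
  have hQD := eigen_mul_ordProd k (L + 1) hDx
  have hQH := lowering_mul_ordProd (x := x) (c := fun j => (L : ℝ) + 1 + (j : ℝ)) k L
    (hHx 0 (by omega))
    (fun j hj => by simpa [x, add_assoc, add_comm, add_left_comm] using hHx (j + 1) (by omega))
    (fun j hj => hPPcomm _ _ (by omega) (by omega) (by omega)) hbase
    (fun j hj => hPPcomm _ _ (by omega) (by omega) (by omega))
    (fun j hj => hMP _ (by omega))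
  have smul_real (a : A) (r : ℝ) (w : V) : a • r • w = r • a • w := by
    rw [← algebraMap_smul A r w, ← mul_smul, ← Algebra.commutes, mul_smul, algebraMap_smul]
  have hC2 : ((h : ℝ) * ((h : ℝ) - 1) / 2 * 1 * -2) • (C ^ (h - 2) * C)
      = (-((h : ℝ) * ((h : ℝ) - 1))) • C ^ (h - 1) := by
    rcases h with _ | _ | h
    · simp
    · simp
    · rw [← pow_succ]
      congr 1
      ring
  rw [hC2] at hC
  have hD' : D • ordProd x k (L + 1) • v
      = (δ - ∑ j ∈ Finset.range (L + 1), (2 * (j : ℝ) + 1) * k j) • ordProd x k (L + 1) • v := by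
    rw [← mul_smul, hQD, add_smul, mul_smul, hDv, smul_real, smul_assoc, ← add_smul]
    congr 1
    rw [sub_eq_add_neg, ← Finset.sum_neg_distrib]
    congr 1
    exact Finset.sum_congr rfl fun j _ => by ring
  have mul_smul_vec (a b : A) (w : V) : (a * b) • w = a • b • w := mul_smul a b w
  have sub_smul_vec (a b : A) (w : V) : (a - b) • w = a • w - b • w := sub_smul a b w
  have hH' := congrArg (· • v) hQH
  simp only [add_zero, sub_smul_vec, mul_smul_vec, smul_assoc, hHv, hPv L le_rfl,
    hMv, smul_real, smul_zero, zero_sub, neg_zero, Finset.sum_smul] at hH'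
  simp only [ket_eq, mul_smul_vec]
  rw [← mul_smul H, hC]
  simp only [sub_smul_vec, mul_smul_vec, smul_assoc, hD', hH', smul_real, smul_sub, Finset.smul_sum,
    smul_neg, mul_one]
  push_cast [Nat.factorial_succ]
  generalize C ^ (h - 1) • ordProd x k (L + 1) • v = w₁
  generalize C ^ h • ordProd x (Function.update k 0 (k 0 - 2)) (L + 1) • v = w₂
  generalize Finset.sum (M := V) _ _ = w₃
  module
end

section
/- (Lemma 3, P-action) With the centrally extended conformal Galilei algebra relations in A and a highest weight vector v in an A-module V, for (h, k_0, …, k_L) ∈ ℕ^{L+2} let |h,k⟩ := C^h·P_{L+1}^{k_0}·P_{L+2}^{k_1}⋯P_{2L+1}^{k_L}·v. Then for every a with 0 ≤ a ≤ L: P_{L−a}·|h,k⟩ = Σ_{n=0}^{a} (−1)^n·k_{a−n}·I_{L−a+n}·n!·C(h,n)·C(L+1+a,n)·μ·|h−n; k with k_{a−n} decreased by 1⟩ + Σ_{n=a+1}^{min(h, L+1+a)} (−1)^n·n!·C(h,n)·C(L+1+a,n)·|h−n; k with k_{n−a−1} increased by 1⟩, where C(a,b) is the binomial coefficient (which vanishes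 for b > a, truncating the sums) and any term whose scalar coefficient is zero is interpreted as 0. -/
section PowerProducts

variable {A : Type*} [Ring A]

theorem mul_pow_eq_of_commutator {x y c : A} (hxy : y * x - x * y = c) (hc : Commute c x)
    (k : ℕ) : y * x ^ k = x ^ k * y + (k : A) * (c * x ^ (k - 1)) := by
  have hyx : y * x = x * y + c := by rw [← hxy]; abel
  induction k with
  | zero => simp
  | succ k ih =>
    have hk : (k : A) * (c * x ^ (k - 1)) * x = (k : A) * (c * x ^ k) := by
      cases k with
      | zero => simp
      | succ k => simp only [mul_assoc, Nat.add_sub_cancel, pow_succ]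
    rw [pow_succ, ← mul_assoc, ih, add_mul, hk, mul_assoc, hyx, mul_add,
      ← (hc.pow_right k).eq, Nat.add_sub_cancel, Nat.cast_succ, add_mul, one_mul]
    simp only [mul_assoc]
    abel

theorem prod_range_pow_succ (f : ℕ → A) (k : ℕ → ℕ) (n : ℕ) :
    ((List.range (n + 1)).map fun j => f j ^ k j).prod
      = ((List.range n).map fun j => f j ^ k j).prod * f n ^ k n := by
  simp [List.range_succ]

theorem prod_range_pow_congr (f : ℕ → A) {k k' : ℕ → ℕ} {n : ℕ}
    (h : ∀ j < n, k j = k' j) :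
    ((List.range n).map fun j => f j ^ k j).prod
      = ((List.range n).map fun j => f j ^ k' j).prod := by
  congr 1
  refine List.map_congr_left fun j hj => ?_
  rw [h j (List.mem_range.mp hj)]

theorem commute_prod_range_pow {f : ℕ → A} {y : A} {n : ℕ} (h : ∀ j < n, Commute y (f j))
    (k : ℕ → ℕ) : Commute y ((List.range n).map fun j => f j ^ k j).prod := by
  refine Commute.list_prod_right _ _ fun x hx => ?_
  obtain ⟨j, hj, rfl⟩ := List.mem_map.mp hx
  exact (h j (List.mem_range.mp hj)).pow_right _

/-- Multiplying an ordered monomial by one of its pairwise commuting letters raises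
the exponent of that letter. -/
theorem mul_prod_range_pow {f : ℕ → A} {i n : ℕ} (hi : i < n)
    (h : ∀ j < n, Commute (f i) (f j)) (k : ℕ → ℕ) :
    f i * ((List.range n).map fun j => f j ^ k j).prod
      = ((List.range n).map fun j => f j ^ Function.update k i (k i + 1) j).prod := by
  induction n with
  | zero => omega
  | succ n ih =>
    rw [prod_range_pow_succ, prod_range_pow_succ]
    rcases Nat.lt_succ_iff_lt_or_eq.mp hi with hin | rfl
    · rw [← mul_assoc, ih hin fun j hj => h j (by omega), Function.update_of_ne hin.ne']
    · rw [Function.update_self, pow_succ', ← mul_assoc, ← mul_assoc,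
        (commute_prod_range_pow (fun j hj => h j (by omega)) k).eq]
      congr 2
      exact prod_range_pow_congr f fun j hj => (Function.update_of_ne hj.ne _ _).symm

/-- If `y` commutes with every letter except `f i`, and its commutator with `f i` is central
among the letters, then `y` acts on an ordered monomial as a derivation in the letter `f i`. -/
theorem mul_prod_range_pow_of_commutator {f : ℕ → A} {y c : A} {i n : ℕ} (hi : i < n)
    (hy : ∀ j < n, j ≠ i → Commute y (f j)) (hyi : y * f i - f i * y = c)
    (hc : ∀ j < n, Commute c (f j)) (k : ℕ → ℕ) :
    y * ((List.range n).map fun j => f j ^ k j).prod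
      = ((List.range n).map fun j => f j ^ k j).prod * y
        + (k i : A) * (((List.range n).map fun j =>
            f j ^ Function.update k i (k i - 1) j).prod * c) := by
  induction n with
  | zero => omega
  | succ n ih =>
    simp only [prod_range_pow_succ]
    rcases Nat.lt_succ_iff_lt_or_eq.mp hi with hin | rfl
    · have hyn : Commute y (f n ^ k n) := (hy n (by omega) hin.ne').pow_right _
      have hcn : Commute c (f n ^ k n) := (hc n (by omega)).pow_right _
      rw [← mul_assoc, ih hin (fun j hj => hy j (by omega)) (fun j hj => hc j (by omega)),
        Function.update_of_ne hin.ne', add_mul]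
      simp only [mul_assoc, hyn.eq, hcn.eq]
    · have hW : Commute y ((List.range i).map fun j => f j ^ k j).prod :=
        commute_prod_range_pow (fun j hj => hy j (by omega) hj.ne) k
      have hup : ((List.range i).map fun j => f j ^ Function.update k i (k i - 1) j).prod
          = ((List.range i).map fun j => f j ^ k j).prod :=
        prod_range_pow_congr f fun j hj => Function.update_of_ne hj.ne _ _
      rw [hup, Function.update_self, ← mul_assoc, hW.eq, mul_assoc,
        mul_pow_eq_of_commutator hyi (hc i (by omega)),
        ((hc i (by omega)).pow_right (k i - 1)).eq, mul_add, ← mul_assoc, ← mul_assoc,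
        ← (Nat.cast_commute (k i) _).eq]
      simp only [mul_assoc]

/-- Moving `P m` to the right through a power of `C`, when `ad C` shifts the sequence `P`. -/
theorem mul_pow_eq_sum_of_shift {C : A} {P : ℕ → A} {T : ℕ}
    (hCP : ∀ n, n ≤ T → C * P n - P n * C = ((T - n : ℕ) : A) * P (n + 1)) (h : ℕ) :
    ∀ N m : ℕ, N + m = T → P m * C ^ h
      = ∑ n ∈ Finset.range (h + 1),
          ((-1) ^ n * (h.choose n * N.descFactorial n : ℕ) : ℤ) • (C ^ (h - n) * P (m + n)) := by
  induction h with
  | zero => intro N m _; simp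
  | succ h ih =>
    intro N m hm
    have hstep : P m * C = C * P m - (N : ℤ) • P (m + 1) := by
      have h1 := hCP m (by omega)
      rw [show T - m = N by omega] at h1
      rw [zsmul_eq_mul, Int.cast_natCast, ← h1]
      abel
    have hC : C * (P m * C ^ h) = ∑ n ∈ Finset.range (h + 2),
        ((-1) ^ n * (h.choose n * N.descFactorial n : ℕ) : ℤ)
          • (C ^ (h + 1 - n) * P (m + n)) := by
      rw [ih N m hm, Finset.sum_range_succ _ (h + 1), Nat.choose_succ_self, Finset.mul_sum]
      simp only [zero_mul, Nat.cast_zero, mul_zero, zero_smul, add_zero]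
      refine Finset.sum_congr rfl fun n hn => ?_
      have := Finset.mem_range.mp hn
      rw [mul_smul_comm, ← mul_assoc, ← pow_succ', show h - n + 1 = h + 1 - n by omega]
    have hN : (N : ℤ) • (P (m + 1) * C ^ h) = ∑ n ∈ Finset.range (h + 1),
        ((-1) ^ n * (h.choose n * N.descFactorial (n + 1) : ℕ) : ℤ)
          • (C ^ (h - n) * P (m + (n + 1))) := by
      cases N with
      | zero => simp
      | succ N =>
        rw [ih N (m + 1) (by omega), Finset.smul_sum]
        refine Finset.sum_congr rfl fun n _ => ?_
        rw [smul_smul, Nat.succ_descFactorial_succ, add_assoc, add_comm 1 n]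
        congr 1
        push_cast
        ring
    rw [pow_succ', ← mul_assoc, hstep, sub_mul, mul_assoc, smul_mul_assoc, hC, hN,
      Finset.sum_range_succ', Finset.sum_range_succ' _ (h + 1)]
    simp only [Nat.add_sub_add_right]
    rw [add_sub_right_comm, ← Finset.sum_sub_distrib]
    congr 1
    · refine Finset.sum_congr rfl fun n _ => ?_
      rw [← sub_smul]
      congr 1
      rw [Nat.choose_succ_succ]
      push_cast
      ring
    · simp

end PowerProducts


/-- Lemma 3, `P`-action.  With the centrally extended conformal
Galilei algebra relations and highest weight vector `v`, for `0 ≤ a ≤ L`: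
`P_{L-a}|h,k⟩ = ∑_{n=0}^{a} (-1)^n k_{a-n} I_{L-a+n} n! C(h,n) C(L+1+a,n) μ |h-n, k-e_{a-n}⟩
 + ∑_{n=a+1}^{min(h,L+1+a)} (-1)^n n! C(h,n) C(L+1+a,n) |h-n, k+e_{n-a-1}⟩`,
with binomial coefficients truncating the sums and terms with vanishing scalar
coefficient interpreted as `0`. -/
theorem stmt9 (L : ℕ) (A : Type*) [Ring A] [Algebra ℝ A]
    (C D H M : A) (P : ℕ → A)
    (V : Type*) [AddCommGroup V] [Module ℝ V] [Module A V] [IsScalarTower ℝ A V]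
    (v : V) (δ μ : ℝ)
    (hPtop : P (2 * L + 2) = 0)
    (hMC : M * C = C * M) (hMD : M * D = D * M) (hMH : M * H = H * M)
    (hMP : ∀ n, n ≤ 2 * L + 1 → M * P n = P n * M)
    (hDH : D * H - H * D = 2 * H)
    (hDC : D * C - C * D = -(2 * C))
    (hCH : C * H - H * C = D)
    (hHP0 : H * P 0 - P 0 * H = 0)
    (hHP : ∀ n, 1 ≤ n → n ≤ 2 * L + 1 → H * P n - P n * H = -((n : A) * P (n - 1)))
    (hDP : ∀ n, n ≤ 2 * L + 1 →
      D * P n - P n * D = (((2 * L + 1 : ℤ) - 2 * (n : ℤ) : ℤ) : A) * P n)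
    (hCP : ∀ n, n ≤ 2 * L + 1 →
      C * P n - P n * C = ((2 * L + 1 - n : ℕ) : A) * P (n + 1))
    (hPPcomm : ∀ a b, a ≤ 2 * L + 1 → b ≤ 2 * L + 1 → a + b ≠ 2 * L + 1 →
      P a * P b = P b * P a)
    (hPP : ∀ a, a ≤ 2 * L + 1 →
      P a * P (2 * L + 1 - a) - P (2 * L + 1 - a) * P a = ((cgaI L a : ℤ) : A) * M)
    (hDv : D • v = δ • v) (hMv : M • v = μ • v) (hHv : H • v = (0 : V))
    (hPv : ∀ n, n ≤ L → P n • v = 0) :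
    ∀ (h : ℕ) (k : ℕ → ℕ) (a : ℕ), a ≤ L →
      P (L - a) • ket L C P v h k
        = (∑ n ∈ Finset.range (a + 1),
            ((-1 : ℝ) ^ n * (k (a - n) : ℝ) * ((cgaI L (L - a + n) : ℤ) : ℝ)
                * (n.factorial : ℝ) * (h.choose n : ℝ) * ((L + 1 + a).choose n : ℝ) * μ)
              • ket L C P v (h - n) (Function.update k (a - n) (k (a - n) - 1)))
          + ∑ n ∈ Finset.Icc (a + 1) (min h (L + 1 + a)),
              ((-1 : ℝ) ^ n * (n.factorial : ℝ) * (h.choose n : ℝ)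
                  * ((L + 1 + a).choose n : ℝ))
                • ket L C P v (h - n)
                    (Function.update k (n - a - 1) (k (n - a - 1) + 1)) := by
  intro h k a ha
  let W : (ℕ → ℕ) → A :=
    fun k => ((List.range (L + 1)).map fun j => P (L + 1 + j) ^ k j).prod
  have hket : ∀ h k, ket L C P v h k = (C ^ h * W k) • v := fun _ _ => rfl
  have hzr : ∀ (z : ℤ) (x : V), z • x = (z : ℝ) • x := fun z x =>
    (Int.cast_smul_eq_zsmul ℝ z x).symm
  have hAr : ∀ (r : ℝ) (y : A) (x : V), y • r • x = r • y • x := by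
    intro r y x
    rw [← algebraMap_smul A r x, ← algebraMap_smul A r (y • x), smul_smul, smul_smul,
      Algebra.commutes]
  have hcomm : ∀ i < L + 1, ∀ j < L + 1, Commute (P (L + 1 + i)) (P (L + 1 + j)) :=
    fun i hi j hj => hPPcomm _ _ (by omega) (by omega) (by omega)
  have hraise : ∀ i < L + 1, P (L + 1 + i) * W k = W (Function.update k i (k i + 1)) :=
    fun i hi =>
    mul_prod_range_pow (f := fun j => P (L + 1 + j)) hi (hcomm i hi) k
  have hlower : ∀ i < L + 1, (P (L - i) * W k) • v
      = ((k i : ℝ) * (cgaI L (L - i) : ℝ) * μ) • W (Function.update k i (k i - 1)) • v := by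
    intro i hi
    have hM : ∀ j < L + 1, Commute ((cgaI L (L - i) : A) * M) (P (L + 1 + j)) := fun j hj =>
      (Int.cast_commute _ _).mul_left (hMP _ (by omega))
    have hPi := hPP (L - i) (by omega)
    rw [show 2 * L + 1 - (L - i) = L + 1 + i by omega] at hPi
    have key := mul_prod_range_pow_of_commutator (f := fun j => P (L + 1 + j)) hi
      (fun j hj hji => hPPcomm (L - i) (L + 1 + j) (by omega) (by omega) (by omega)) hPi hM k
    rw [show P (L - i) * W k = _ from key]
    rw [add_smul, mul_smul, hPv _ (by omega), smul_zero, zero_add, mul_smul, mul_smul, mul_smul,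
      hMv, Nat.cast_smul_eq_nsmul, Int.cast_smul_eq_zsmul, hzr, hAr, hAr,
      ← Nat.cast_smul_eq_nsmul ℝ, smul_smul, smul_smul, mul_assoc]
  have hterm : ∀ n, ((-1 : ℤ) ^ n * (h.choose n * (L + 1 + a).descFactorial n : ℕ) : ℤ)
        • ((C ^ (h - n) * P (L - a + n) * W k) • v)
      = ((-1 : ℝ) ^ n * (n.factorial : ℝ) * (h.choose n : ℝ) * ((L + 1 + a).choose n : ℝ))
        • C ^ (h - n) • (P (L - a + n) * W k) • v := by
    intro n
    rw [hzr, mul_assoc, mul_smul (C ^ (h - n)), Nat.descFactorial_eq_factorial_mul_choose]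
    congr 1
    push_cast
    ring
  rw [hket, smul_smul, ← mul_assoc,
    mul_pow_eq_sum_of_shift hCP h (L + 1 + a) (L - a) (by omega), Finset.sum_mul,
    Finset.sum_smul]
  simp only [smul_mul_assoc, smul_assoc, hterm]
  have hvanish : ∀ n, min h (L + 1 + a) < n →
      ((-1 : ℝ) ^ n * (n.factorial : ℝ) * (h.choose n : ℝ) * ((L + 1 + a).choose n : ℝ))
        • C ^ (h - n) • (P (L - a + n) * W k) • v = 0 := by
    intro n hn
    rcases min_lt_iff.mp hn with hn | hn <;> simp [Nat.choose_eq_zero_of_lt hn]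
  have hsplit : ∀ g : ℕ → V, (∀ n, min h (L + 1 + a) < n → g n = 0) →
      ∑ n ∈ Finset.range (h + 1), g n
        = ∑ n ∈ Finset.range (a + 1), g n
          + ∑ n ∈ Finset.Icc (a + 1) (min h (L + 1 + a)), g n := by
    intro g hg
    rw [← Finset.sum_union (Finset.disjoint_left.mpr fun n hn hn' => by
      simp only [Finset.mem_range, Finset.mem_Icc] at hn hn'; omega)]
    have hsub : ∀ s : Finset ℕ, Finset.range (min h (L + 1 + a) + 1) ⊆ s →
        ∑ n ∈ s, g n = ∑ n ∈ Finset.range (min h (L + 1 + a) + 1), g n := fun s hs =>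
      (Finset.sum_subset hs fun n _ hn => hg n (by
        rw [Finset.mem_range] at hn; omega)).symm
    rw [hsub (Finset.range (h + 1)), hsub (_ ∪ _)] <;> intro n hn <;>
      simp only [Finset.mem_range, Finset.mem_union, Finset.mem_Icc] at hn ⊢ <;> omega
  rw [hsplit _ hvanish]
  congr 1
  · refine Finset.sum_congr rfl fun n hn => ?_
    have hna := Finset.mem_range.mp hn
    rw [hket, mul_smul (C ^ (h - n)), show L - a + n = L - (a - n) by omega,
      hlower (a - n) (by omega), hAr, smul_smul]
    congr 1
    ring
  · refine Finset.sum_congr rfl fun n hn => ?_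
    have hna := Finset.mem_Icc.mp hn
    rw [hket, mul_smul (C ^ (h - n)), show L - a + n = L + 1 + (n - a - 1) by omega,
      hraise (n - a - 1) (by omega)]
end
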